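/- (Necessary condition for type A blowup, a = 1/2, σ = 0.) Let ν > 0, let ω₀ be a nonzero real number, let v₀ > 0 with v₀ ≠ 1, and suppose there exists t_c ∈ (0,∞) such that e^{-ν t_c} - 1 = (ν/(2ω₀))·f₀(v₀). Then either (0 < v₀ < 1 and ω₀ > -(ν/2)f₀(v₀)) or (v₀ > 1 and ω₀ < -(ν/2)f₀(v₀)). -/

import Mathlib

/-- The auxiliary function `f₀(x) = (x²-1)² + ((x²+1)²/x)(x²-1)·arctan x` for `x > 0`,
extended by `f₀(0) = 0`. -/
noncomputable def f₀ (x : ℝ) : ℝ :=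
  if x = 0 then 0
  else (x ^ 2 - 1) ^ 2 + ((x ^ 2 + 1) ^ 2 / x) * (x ^ 2 - 1) * Real.arctan x

theorem div_one_add_sq_lt_arctan {x : ℝ} (hx : 0 < x) : x / (1 + x ^ 2) < Real.arctan x := by
  have h := Real.sin_lt (mul_pos two_pos (Real.arctan_pos.mpr hx))
  rw [Real.sin_two_mul, Real.sin_arctan, Real.cos_arctan, mul_assoc, div_mul_div_comm,
    Real.mul_self_sqrt (by positivity), mul_one] at h
  linarith

theorem f₀_pos_of_one_lt {x : ℝ} (hx : 1 < x) : 0 < f₀ x := by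
  have hx0 : 0 < x := by linarith
  have h1 : 0 < x ^ 2 - 1 := by nlinarith
  have h2 : 0 < Real.arctan x := Real.arctan_pos.mpr hx0
  rw [f₀, if_neg hx0.ne']
  positivity

theorem f₀_neg_of_lt_one {x : ℝ} (hx0 : 0 < x) (hx : x < 1) : f₀ x < 0 := by
  have h1 : 0 < 1 - x ^ 2 := by nlinarith
  have h2 : x < Real.arctan x * (1 + x ^ 2) :=
    (div_lt_iff₀ (by positivity)).mp (div_one_add_sq_lt_arctan hx0)
  have h3 : 0 < (x ^ 2 + 1) ^ 2 * Real.arctan x - x * (1 - x ^ 2) := by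
    have h4 := mul_lt_mul_of_pos_right h2 (show 0 < 1 + x ^ 2 by positivity)
    have h5 : 0 < x * x ^ 2 := by positivity
    linarith
  have h6 : f₀ x = -((1 - x ^ 2) / x * ((x ^ 2 + 1) ^ 2 * Real.arctan x - x * (1 - x ^ 2))) := by
    rw [f₀, if_neg hx0.ne']
    field_simp
    ring
  rw [h6, neg_lt_zero]
  positivity

/-- Necessary condition for type A blowup (`a = 1/2`, `σ = 0`): if the transcendental
equation `e^{-ν t_c} - 1 = (ν/(2ω₀)) f₀(v₀)` has a solution `t_c ∈ (0,∞)`, then either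
`0 < v₀ < 1` and `ω₀ > -(ν/2) f₀(v₀)`, or `v₀ > 1` and `ω₀ < -(ν/2) f₀(v₀)`. -/
theorem typeA_blowup_necessary
    (ν ω₀ v₀ : ℝ) (hν : 0 < ν) (hω₀ : ω₀ ≠ 0) (hv₀ : 0 < v₀) (hv₀' : v₀ ≠ 1)
    (htc : ∃ tc : ℝ, 0 < tc ∧ Real.exp (-(ν * tc)) - 1 = ν / (2 * ω₀) * f₀ v₀) :
    (0 < v₀ ∧ v₀ < 1 ∧ -(ν / 2) * f₀ v₀ < ω₀) ∨ (1 < v₀ ∧ ω₀ < -(ν / 2) * f₀ v₀) := by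
  obtain ⟨tc, htc, heq⟩ := htc
  have hlt : Real.exp (-(ν * tc)) < 1 := Real.exp_lt_one_iff.mpr (neg_lt_zero.mpr (mul_pos hν htc))
  have hpos := Real.exp_pos (-(ν * tc))
  have hmul : (Real.exp (-(ν * tc)) - 1) * ω₀ = ν / 2 * f₀ v₀ := by
    rw [heq]
    field_simp
  rcases lt_or_gt_of_ne hv₀' with h | h
  · have hf : ν / 2 * f₀ v₀ < 0 := mul_neg_of_pos_of_neg (by positivity) (f₀_neg_of_lt_one hv₀ h)
    have hω : 0 < ω₀ := by
      by_contra! hc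
      nlinarith
    exact Or.inl ⟨hv₀, h, by nlinarith⟩
  · have hf : 0 < ν / 2 * f₀ v₀ := mul_pos (by positivity) (f₀_pos_of_one_lt h)
    have hω : ω₀ < 0 := by
      by_contra! hc
      nlinarith
    exact Or.inr ⟨h, by nlinarith⟩
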